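/- Let G be an MN3P5 graph with no dominating clique, and let C = v1 v2 v3 v4 v5 be a dominating 5-hole in G. For i = 1,...,5 (indices modulo 5), let X_i be the set of vertices of G not on C that are adjacent to v_{i-1} and v_{i+1} and not adjacent to v_{i+2} and v_{i+3}. Then every vertex of G not on C belongs to exactly one of the sets X_1, X_2, X_3, X_4, X_5. -/

import Mathlib

open SimpleGraph

/-- Build a simple graph on `Fin n` from a list of edges (symmetrized, loops removed). -/
def graphOfList {n : ℕ} (l : List (Fin n × Fin n)) : SimpleGraph (Fin n) :=
  SimpleGraph.fromRel (fun a b => (a, b) ∈ l)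

/-- `K4`: the complete graph on four vertices. -/
def graphK4 : SimpleGraph (Fin 4) := ⊤

/-- `W5`: a 5-cycle `0,1,2,3,4` plus a hub `5` adjacent to all cycle vertices. -/
def graphW5 : SimpleGraph (Fin 6) :=
  graphOfList [(0,1),(1,2),(2,3),(3,4),(4,0),(5,0),(5,1),(5,2),(5,3),(5,4)]

/-- `S1`: 5-cycle `v1..v5 = 0..4`, `u2 = 5` adjacent exactly to `v1,v2,v3`,
`u5 = 6` adjacent exactly to `v1,v4,v5`. -/
def graphS1 : SimpleGraph (Fin 7) :=
  graphOfList [(0,1),(1,2),(2,3),(3,4),(4,0),(5,0),(5,1),(5,2),(6,0),(6,3),(6,4)]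

/-- `S2`: 5-cycle `v1..v5 = 0..4`, `w = 5` adjacent exactly to `v2,v3,v4,v5`,
`x = 6` adjacent exactly to `v1,v3,v4`. -/
def graphS2 : SimpleGraph (Fin 7) :=
  graphOfList [(0,1),(1,2),(2,3),(3,4),(4,0),(5,1),(5,2),(5,3),(5,4),(6,0),(6,2),(6,3)]

/-- `T`: vertices `u1,uA,uB,u2 = 0,1,2,3`, `w1,wA,wB,w2 = 4,5,6,7`, `x1,x2 = 8,9`. -/
def graphT : SimpleGraph (Fin 10) :=
  graphOfList [(0,1),(0,2),(1,2),(1,3),(2,3),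
               (4,5),(4,6),(5,6),(5,7),(6,7),
               (0,4),(0,7),(3,4),(3,7),(1,5),(2,6),
               (8,0),(8,2),(8,4),(8,5),(8,9),
               (9,1),(9,3),(9,6),(9,7)]

/-- `B`: vertices `w = 0`, `u0..u5 = 1..6`, `v0..v5 = 7..12`, with its 39 edges. -/
def graphB : SimpleGraph (Fin 13) :=
  graphOfList [(0,2),(0,3),(0,6),(0,8),(0,9),(0,12),
               (1,2),(1,3),(1,4),(1,6),(1,8),(1,12),
               (2,3),(2,4),(2,5),(2,7),
               (3,9),(3,10),(3,11),
               (4,6),(4,9),(4,10),(4,11),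
               (5,6),(5,9),(5,10),(5,11),(5,12),
               (6,7),(6,11),
               (7,8),(7,9),(7,10),(7,12),
               (8,9),(8,10),(8,11),
               (10,12),(11,12)]

/-- `G` contains an induced copy of the path `P5` on five vertices. -/
def HasInducedP5 {V : Type*} (G : SimpleGraph V) : Prop :=
  ∃ f : Fin 5 ↪ V, ∀ a b : Fin 5, (SimpleGraph.pathGraph 5).Adj a b ↔ G.Adj (f a) (f b)

/-- `G` is `P5`-free: it has no induced subgraph isomorphic to `P5`. -/
def P5Free {V : Type*} (G : SimpleGraph V) : Prop := ¬ HasInducedP5 G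

/-- `G` is an MN3P5 graph: `P5`-free, not 3-colorable, and every proper subgraph
is 3-colorable or contains an induced `P5`. -/
def IsMN3P5 {V : Type*} (G : SimpleGraph V) : Prop :=
  P5Free G ∧ ¬ G.Colorable 3 ∧
  ∀ H : G.Subgraph, H ≠ ⊤ → (H.coe.Colorable 3 ∨ HasInducedP5 H.coe)

/-- `G` is isomorphic to one of the six graphs `K4, W5, S1, S2, T, B`. -/
def IsoToSix {V : Type*} (G : SimpleGraph V) : Prop :=
  Nonempty (G ≃g graphK4) ∨ Nonempty (G ≃g graphW5) ∨ Nonempty (G ≃g graphS1) ∨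
  Nonempty (G ≃g graphS2) ∨ Nonempty (G ≃g graphT) ∨ Nonempty (G ≃g graphB)

/-- `v` traces a 5-hole (an induced 5-cycle) in `G`. -/
def IsFiveHole {V : Type*} (G : SimpleGraph V) (v : Fin 5 → V) : Prop :=
  Function.Injective v ∧ ∀ i j : Fin 5, G.Adj (v i) (v j) ↔ (j = i + 1 ∨ i = j + 1)

/-- `{a, b, c}` is a dominating clique of size 3 in `G`. -/
def IsDomClique3 {V : Type*} (G : SimpleGraph V) (a b c : V) : Prop :=
  a ≠ b ∧ a ≠ c ∧ b ≠ c ∧ G.Adj a b ∧ G.Adj a c ∧ G.Adj b c ∧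
  ∀ x : V, x ≠ a → x ≠ b → x ≠ c → (G.Adj x a ∨ G.Adj x b ∨ G.Adj x c)

/-- `H` is a subgraph of `G` (deleting vertices and edges): there is an injection of
vertices carrying edges to edges. -/
def ContainsSub {V W : Type*} (G : SimpleGraph V) (H : SimpleGraph W) : Prop :=
  ∃ f : W ↪ V, ∀ a b : W, H.Adj a b → G.Adj (f a) (f b)

/-- `G` is minimally non-`k`-colorable: not `k`-colorable, but every proper subgraph is. -/
def MinNonColorable {V : Type*} (k : ℕ) (G : SimpleGraph V) : Prop :=
  ¬ G.Colorable k ∧ ∀ H : G.Subgraph, H ≠ ⊤ → H.coe.Colorable k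


section FiveHole

variable {V : Type*} {G : SimpleGraph V} {v : Fin 5 → V}

/-- Five vertices satisfying the adjacency pattern of a path on five vertices cannot occur in a
`P5`-free graph; distinctness is automatic. -/
lemma P5Free.false_of_path (hP : P5Free G) {a b c d e : V}
    (hab : G.Adj a b) (hbc : G.Adj b c) (hcd : G.Adj c d) (hde : G.Adj d e)
    (hac : ¬ G.Adj a c) (had : ¬ G.Adj a d) (hae : ¬ G.Adj a e)
    (hbd : ¬ G.Adj b d) (hbe : ¬ G.Adj b e) (hce : ¬ G.Adj c e) : False := by
  have hadj : ∀ i j : Fin 5, (SimpleGraph.pathGraph 5).Adj i j ↔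
      G.Adj (![a, b, c, d, e] i) (![a, b, c, d, e] j) := by
    intro i j
    rw [SimpleGraph.pathGraph_adj]
    fin_cases i <;> fin_cases j <;> simp_all [G.adj_comm]
  have hinj : Function.Injective ![a, b, c, d, e] := by
    have hpath : ∀ i j : Fin 5,
        (∀ k : Fin 5, (i.val + 1 = k.val ∨ k.val + 1 = i.val) ↔
          (j.val + 1 = k.val ∨ k.val + 1 = j.val)) → i = j := by decide
    intro i j hij
    refine hpath i j fun k => ?_
    rw [← SimpleGraph.pathGraph_adj, ← SimpleGraph.pathGraph_adj, hadj, hadj, hij]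
  exact hP ⟨⟨_, hinj⟩, hadj⟩

/-- Deleting any vertex of an MN3P5 graph leaves a 3-colorable graph. -/
lemma IsMN3P5.exists_coloring_avoiding (hG : IsMN3P5 G) (z : V) :
    ∃ c : V → Fin 3, ∀ a b, a ≠ z → b ≠ z → G.Adj a b → c a ≠ c b := by
  classical
  have hne : (⊤ : G.Subgraph).induce {z}ᶜ ≠ ⊤ := fun h => by
    have hz : z ∈ ((⊤ : G.Subgraph).induce {z}ᶜ).verts := by rw [h]; trivial
    exact hz rfl
  rcases hG.2.2 _ hne with ⟨⟨c⟩⟩ | ⟨f, hf⟩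
  · refine ⟨fun a => if h : a ≠ z then c ⟨a, h⟩ else 0, fun a b ha hb hab => ?_⟩
    simp only [dif_pos ha, dif_pos hb]
    exact c.valid (show ((⊤ : G.Subgraph).induce {z}ᶜ).Adj a b from ⟨ha, hb, hab⟩)
  · refine absurd ⟨f.trans (Function.Embedding.subtype _), fun i j => ?_⟩ hG.1
    rw [hf i j]
    exact ⟨fun h => h.2.2, fun h => ⟨(f i).2, (f j).2, h⟩⟩

lemma IsFiveHole.adj (hC : IsFiveHole G v) (i j : Fin 5)
    (h : j = i + 1 ∨ i = j + 1 := by decide) : G.Adj (v i) (v j) :=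
  (hC.2 i j).2 h

lemma IsFiveHole.not_adj (hC : IsFiveHole G v) (i j : Fin 5)
    (h : ¬ (j = i + 1 ∨ i = j + 1) := by decide) : ¬ G.Adj (v i) (v j) :=
  fun h' => h ((hC.2 i j).1 h')

lemma IsFiveHole.rotate (hC : IsFiveHole G v) (k : Fin 5) :
    IsFiveHole G (fun i => v (i + k)) := by
  refine ⟨fun i j h => by simpa using hC.1 h, fun i j => ?_⟩
  rw [hC.2]
  simp only [add_right_comm _ k 1, add_left_inj]

lemma IsFiveHole.adj_forward (hC : IsFiveHole G v) (hP : P5Free G) {x : V} (i : Fin 5)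
    (h : G.Adj x (v i)) :
    G.Adj x (v (i + 1)) ∨ G.Adj x (v (i + 2)) ∨ G.Adj x (v (i + 3)) := by
  by_contra! hn
  refine hP.false_of_path h (hC.adj i (i + 1) ?_) (hC.adj (i + 1) (i + 2) ?_)
    (hC.adj (i + 2) (i + 3) ?_) hn.1 hn.2.1 hn.2.2 (hC.not_adj i (i + 2) ?_)
    (hC.not_adj i (i + 3) ?_) (hC.not_adj (i + 1) (i + 3) ?_) <;>
    (clear h hn; revert i; decide)

lemma IsFiveHole.adj_backward (hC : IsFiveHole G v) (hP : P5Free G) {x : V} (i : Fin 5)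
    (h : G.Adj x (v i)) :
    G.Adj x (v (i + 4)) ∨ G.Adj x (v (i + 3)) ∨ G.Adj x (v (i + 2)) := by
  by_contra! hn
  refine hP.false_of_path h (hC.adj i (i + 4) ?_) (hC.adj (i + 4) (i + 3) ?_)
    (hC.adj (i + 3) (i + 2) ?_) hn.1 hn.2.1 hn.2.2 (hC.not_adj i (i + 3) ?_)
    (hC.not_adj i (i + 2) ?_) (hC.not_adj (i + 4) (i + 2) ?_) <;>
    (clear h hn; revert i; decide)

/-- In a graph with no dominating clique, every triangle misses some vertex. -/
lemma exists_not_adj_triangle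
    (hnodom : ¬ ∃ S : Set V, G.IsClique S ∧ ∀ x ∉ S, ∃ u ∈ S, G.Adj x u)
    {a b c : V} (hab : G.Adj a b) (hac : G.Adj a c) (hbc : G.Adj b c) :
    ∃ z, ¬ G.Adj z a ∧ ¬ G.Adj z b ∧ ¬ G.Adj z c := by
  by_contra! h
  refine hnodom ⟨{a, b, c}, ?_, fun x _ => ?_⟩
  · simp [SimpleGraph.isClique_iff, Set.pairwise_insert, hab, hac, hbc, hab.symm, hac.symm,
      hbc.symm]
  · by_cases ha : G.Adj x a
    · exact ⟨a, by simp, ha⟩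
    by_cases hb : G.Adj x b
    · exact ⟨b, by simp, hb⟩
    exact ⟨c, by simp, h x ha hb⟩

lemma IsFiveHole.not_adj_zero_two_three (hC : IsFiveHole G v) (hP : P5Free G)
    (hnodom : ¬ ∃ S : Set V, G.IsClique S ∧ ∀ x ∉ S, ∃ u ∈ S, G.Adj x u)
    (hdom : ∀ x : V, (∀ i : Fin 5, x ≠ v i) → ∃ i : Fin 5, G.Adj x (v i)) {x : V}
    (h0 : G.Adj x (v 0)) (h1 : ¬ G.Adj x (v 1)) (h2 : G.Adj x (v 2)) (h3 : G.Adj x (v 3))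
    (h4 : ¬ G.Adj x (v 4)) : False := by
  obtain ⟨y, hx, hy2, hy3⟩ := exists_not_adj_triangle hnodom h2 h3 (hC.adj 2 3)
  have hyC : ∀ i, y ≠ v i := by
    intro i hi
    subst hi
    fin_cases i
    exacts [hx h0.symm, hy2 (hC.adj 1 2), hx h2.symm, hx h3.symm, hy3 (hC.adj 4 3)]
  have h04 : G.Adj y (v 0) → G.Adj y (v 4) := fun h => by
    simpa [hy2, hy3] using hC.adj_backward hP 0 h
  have h41 : G.Adj y (v 4) → G.Adj y (v 1) := fun h => by
    simpa [hy2, hy3] using hC.adj_backward hP 4 h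
  have h14 : G.Adj y (v 1) → G.Adj y (v 0) ∨ G.Adj y (v 4) := fun h => by
    simpa [hy2, hy3] using hC.adj_backward hP 1 h
  have hy : G.Adj y (v 1) ∧ G.Adj y (v 4) := by
    obtain ⟨i, hi⟩ := hdom y hyC
    fin_cases i <;> simp at hi <;> tauto
  exact hP.false_of_path h2 (hC.adj 2 1) hy.1.symm hy.2 h1 (fun h => hx h.symm) h4
    (fun h => hy2 h.symm) (hC.not_adj 2 4) (hC.not_adj 1 4)

lemma IsFiveHole.not_adj_four (hC : IsFiveHole G v) (hG : IsMN3P5 G)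
    (hnodom : ¬ ∃ S : Set V, G.IsClique S ∧ ∀ x ∉ S, ∃ u ∈ S, G.Adj x u)
    (hdom : ∀ x : V, (∀ i : Fin 5, x ≠ v i) → ∃ i : Fin 5, G.Adj x (v i)) {w : V}
    (h0 : ¬ G.Adj w (v 0)) (h1 : G.Adj w (v 1)) (h2 : G.Adj w (v 2)) (h3 : G.Adj w (v 3))
    (h4 : G.Adj w (v 4)) : False := by
  have hP := hG.1
  obtain ⟨y, hw, hy1, hy2⟩ := exists_not_adj_triangle hnodom h1 h2 (hC.adj 1 2)
  have hyC : ∀ i, y ≠ v i := by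
    intro i hi
    subst hi
    fin_cases i
    exacts [hy1 (hC.adj 0 1), hw h1.symm, hw h2.symm, hw h3.symm, hw h4.symm]
  have h04 : G.Adj y (v 0) → G.Adj y (v 4) := fun h => by
    by_contra hn
    exact hP.false_of_path h (hC.adj 0 4) h4.symm h2 hn (fun h' => hw h') hy2
      (fun h' => h0 h'.symm) (hC.not_adj 0 2) (hC.not_adj 4 2)
  have h43 : G.Adj y (v 4) → G.Adj y (v 3) := fun h => by
    simpa [hy1, hy2] using hC.adj_backward hP 4 h
  have h30 : G.Adj y (v 3) → G.Adj y (v 0) := fun h => by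
    simpa [hy1, hy2] using hC.adj_backward hP 3 h
  have hy : G.Adj y (v 0) ∧ G.Adj y (v 3) ∧ G.Adj y (v 4) := by
    obtain ⟨i, hi⟩ := hdom y hyC
    fin_cases i <;> simp at hi <;> tauto
  obtain ⟨z, hzw, hz3, hz4⟩ := exists_not_adj_triangle hnodom h3 h4 (hC.adj 3 4)
  obtain ⟨c, hc⟩ := hG.exists_coloring_avoiding z
  have hzC : ∀ i, v i ≠ z := by
    intro i hi
    subst hi
    fin_cases i
    exacts [hz4 (hC.adj 0 4), hzw h1.symm, hzw h2.symm, hzw h3.symm, hzw h4.symm]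
  have hwz : w ≠ z := fun h => hz3 (h ▸ h3)
  have hyz : y ≠ z := fun h => hz3 (h ▸ hy.2.1)
  have c01 := hc _ _ (hzC _) (hzC _) (hC.adj 0 1)
  have c12 := hc _ _ (hzC _) (hzC _) (hC.adj 1 2)
  have c23 := hc _ _ (hzC _) (hzC _) (hC.adj 2 3)
  have c34 := hc _ _ (hzC _) (hzC _) (hC.adj 3 4)
  have c40 := hc _ _ (hzC _) (hzC _) (hC.adj 4 0)
  have cw1 := hc _ _ hwz (hzC _) h1
  have cw2 := hc _ _ hwz (hzC _) h2
  have cw3 := hc _ _ hwz (hzC _) h3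
  have cw4 := hc _ _ hwz (hzC _) h4
  have cy0 := hc _ _ hyz (hzC _) hy.1
  have cy3 := hc _ _ hyz (hzC _) hy.2.1
  have cy4 := hc _ _ hyz (hzC _) hy.2.2
  omega

lemma IsFiveHole.exists_not_adj (hC : IsFiveHole G v) (hG : IsMN3P5 G)
    (hnodom : ¬ ∃ S : Set V, G.IsClique S ∧ ∀ x ∉ S, ∃ u ∈ S, G.Adj x u) (w : V) :
    ∃ i, ¬ G.Adj w (v i) := by
  by_contra! hw
  obtain ⟨z, hzw, hz0, -⟩ := exists_not_adj_triangle hnodom (hw 0) (hw 1) (hC.adj 0 1)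
  obtain ⟨c, hc⟩ := hG.exists_coloring_avoiding z
  have hzC : ∀ i, v i ≠ z := fun i hi => hzw (hi ▸ (hw i).symm)
  have hwz : w ≠ z := fun h => hz0 (h ▸ hw 0)
  have c01 := hc _ _ (hzC _) (hzC _) (hC.adj 0 1)
  have c12 := hc _ _ (hzC _) (hzC _) (hC.adj 1 2)
  have c23 := hc _ _ (hzC _) (hzC _) (hC.adj 2 3)
  have c34 := hc _ _ (hzC _) (hzC _) (hC.adj 3 4)
  have c40 := hc _ _ (hzC _) (hzC _) (hC.adj 4 0)
  have cw := fun i => hc _ _ hwz (hzC i) (hw i)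
  have cw0 := cw 0
  have cw1 := cw 1
  have cw2 := cw 2
  have cw3 := cw 3
  have cw4 := cw 4
  omega

set_option synthInstance.maxSize 1000 in
/-- A nonempty pattern on the five-cycle whose members are never followed, or preceded, by three
non-members, and which is none of the three remaining excluded shapes, has a unique center. -/
lemma existsUnique_center (p : Fin 5 → Bool) (hne : ∃ i, p i = true)
    (hfwd : ∀ i, p i = true → p (i + 1) = true ∨ p (i + 2) = true ∨ p (i + 3) = true)
    (hbwd : ∀ i, p i = true → p (i + 4) = true ∨ p (i + 3) = true ∨ p (i + 2) = true)
    (hthree : ∀ i, ¬ (p i = true ∧ ¬ p (i + 1) = true ∧ p (i + 2) = true ∧ p (i + 3) = true ∧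
      ¬ p (i + 4) = true))
    (hfour : ∀ i, ¬ (¬ p i = true ∧ p (i + 1) = true ∧ p (i + 2) = true ∧ p (i + 3) = true ∧
      p (i + 4) = true))
    (hfive : ∃ i, ¬ p i = true) :
    ∃! i, p (i - 1) = true ∧ p (i + 1) = true ∧ ¬ p (i + 2) = true ∧ ¬ p (i + 3) = true := by
  revert p
  unfold ExistsUnique
  beta_reduce
  decide

end FiveHole

theorem mn3p5_dom_five_hole_partition
    {V : Type*} [Fintype V] (G : SimpleGraph V) (hG : IsMN3P5 G)
    (hnodom : ¬ ∃ S : Set V, G.IsClique S ∧ ∀ x ∉ S, ∃ u ∈ S, G.Adj x u)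
    (v : Fin 5 → V) (hC : IsFiveHole G v)
    (hdom : ∀ x : V, (∀ i : Fin 5, x ≠ v i) → ∃ i : Fin 5, G.Adj x (v i))
    (X : Fin 5 → Set V)
    (hX : ∀ i : Fin 5, X i = {x : V | (∀ j : Fin 5, x ≠ v j) ∧
        G.Adj x (v (i - 1)) ∧ G.Adj x (v (i + 1)) ∧
        ¬ G.Adj x (v (i + 2)) ∧ ¬ G.Adj x (v (i + 3))}) :
    ∀ x : V, (∀ j : Fin 5, x ≠ v j) → ∃! i : Fin 5, x ∈ X i := by
  classical
  intro x hx
  have hdom' : ∀ k y, (∀ i, y ≠ v (i + k)) → ∃ i, G.Adj y (v (i + k)) := by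
    intro k y hy
    obtain ⟨i, hi⟩ := hdom y fun i => by simpa using hy (i - k)
    exact ⟨i - k, by simpa using hi⟩
  have key := existsUnique_center (fun i => decide (G.Adj x (v i)))
  simp only [decide_eq_true_eq] at key
  have := key (hdom x hx) (fun i => hC.adj_forward hG.1 i) (fun i => hC.adj_backward hG.1 i)
    (fun i h => (hC.rotate i).not_adj_zero_two_three hG.1 hnodom (hdom' i) (x := x)
      (by simpa [add_comm] using h.1) (by simpa [add_comm] using h.2.1)
      (by simpa [add_comm] using h.2.2.1) (by simpa [add_comm] using h.2.2.2.1)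
      (by simpa [add_comm] using h.2.2.2.2))
    (fun i h => (hC.rotate i).not_adj_four hG hnodom (hdom' i) (w := x)
      (by simpa [add_comm] using h.1) (by simpa [add_comm] using h.2.1)
      (by simpa [add_comm] using h.2.2.1) (by simpa [add_comm] using h.2.2.2.1)
      (by simpa [add_comm] using h.2.2.2.2))
    (hC.exists_not_adj hG hnodom x)
  simpa [hX, hx] using this
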